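/- Let O be an L-theory, ψ an L-sentence, V a finite uniform interpolant of O ∪ {¬ψ} for S_A, and V* = {β_1, …, β_n} ⊆ V (with each β_i an S_A-sentence) a subset such that O ∪ V* ⊨ β for every β ∈ V ∖ V*; let H = ¬β_1 ∨ … ∨ ¬β_n. Suppose H' is an S_A-sentence such that O ∪ {H'} ⊨ ψ and H' is semantically minimal, i.e., O ∪ {H''} ⊨ H' for every S_A-sentence H'' with O ∪ {H''} ⊨ ψ. Then O ∪ {H} ⊨ H' and O ∪ {H'} ⊨ H; hence O ∪ {H} and O ∪ {H'} entail exactly the same sentences. -/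

import Mathlib

open FirstOrder Language

namespace Abduction

variable {L' L : FirstOrder.Language}

/-- An `L`-sentence is an `S_A`-sentence (w.r.t. the language homomorphism `ι`)
if it is the image under `ι` of some `L'`-sentence. -/
def IsSA (ι : L' →ᴸ L) (φ : L.Sentence) : Prop :=
  ∃ β : L'.Sentence, ι.onSentence β = φ

/-- `V` is a uniform interpolant of `O` for the abducible signature given by `ι`:
`V` is an `S_A`-theory and for every `S_A`-sentence `β`, `O ⊨ β` iff `V ⊨ β`. -/
def IsUniformInterpolant (ι : L' →ᴸ L) (O V : L.Theory) : Prop :=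
  (∀ β ∈ V, IsSA ι β) ∧ ∀ φ : L.Sentence, IsSA ι φ → ((O ⊨ᵇ φ) ↔ (V ⊨ᵇ φ))

/-- Finite disjunction `b 0 ∨ ... ∨ b (n-1)`; the empty disjunction is `⊥`. -/
def disj {L : FirstOrder.Language} : {n : ℕ} → (Fin n → L.Sentence) → L.Sentence
  | 0, _ => ⊥
  | _ + 1, b => b 0 ⊔ disj fun i => b i.succ

/-- Disjunction of a list of sentences; the empty disjunction is `⊥`. -/
def ldisj {L : FirstOrder.Language} : List L.Sentence → L.Sentence
  | [] => ⊥
  | φ :: rest => φ ⊔ ldisj rest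

open Classical in
/-- Single-pass redundancy elimination: go through the enumeration, removing an axiom
if it is entailed by `O` together with the remaining axioms. -/
noncomputable def spre (O : L.Theory) : List L.Sentence → L.Theory → L.Theory
  | [], R => R
  | β :: rest, R => spre O rest (if (O ∪ (R \ {β})) ⊨ᵇ β then R \ {β} else R)


section Helpers

variable {ι : L' →ᴸ L} {φ χ : L.Sentence}

theorem isSA_bot : IsSA ι ⊥ := ⟨⊥, rfl⟩

theorem IsSA.not (hφ : IsSA ι φ) : IsSA ι φ.not := by
  obtain ⟨β, rfl⟩ := hφ
  exact ⟨β.not, rfl⟩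

theorem IsSA.sup (hφ : IsSA ι φ) (hχ : IsSA ι χ) : IsSA ι (φ ⊔ χ) := by
  obtain ⟨β, rfl⟩ := hφ
  obtain ⟨γ, rfl⟩ := hχ
  exact ⟨β ⊔ γ, rfl⟩

theorem isSA_disj : ∀ {n : ℕ} {b : Fin n → L.Sentence}, (∀ i, IsSA ι (b i)) → IsSA ι (disj b)
  | 0, _, _ => isSA_bot
  | _ + 1, _, h => (h 0).sup (isSA_disj fun i => h i.succ)

theorem realize_disj (M : Type*) [L.Structure M] :
    ∀ {n : ℕ} (b : Fin n → L.Sentence), M ⊨ disj b ↔ ∃ i, M ⊨ b i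
  | 0, _ => by simp [disj, Sentence.Realize]
  | _ + 1, b => by
    have h := realize_disj M fun i => b i.succ
    rw [Fin.exists_fin_succ, ← h]
    exact Formula.realize_sup

theorem union_models_iff.{u, v} {L : FirstOrder.Language.{u, v}} {T S : L.Theory}
    {χ : L.Sentence} : (T ∪ S) ⊨ᵇ χ ↔ ∀ M : Theory.ModelType.{u, v, max u v} T, M ⊨ S → M ⊨ χ := by
  rw [Theory.models_sentence_iff]
  refine ⟨fun h M hM => ?_, fun h M => ?_⟩
  · have : M ⊨ T ∪ S := Theory.model_union_iff.2 ⟨M.is_model, hM⟩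
    exact h (Theory.ModelType.of _ M)
  · have hM := Theory.model_union_iff.1 M.is_model
    have := hM.1
    exact h (Theory.ModelType.of T M) hM.2

theorem union_singleton_models_iff.{u, v} {L : FirstOrder.Language.{u, v}} {T : L.Theory}
    {φ χ : L.Sentence} : (T ∪ {φ}) ⊨ᵇ χ ↔ ∀ M : Theory.ModelType.{u, v, max u v} T, M ⊨ φ → M ⊨ χ := by
  simp only [union_models_iff, Theory.model_singleton_iff]

end Helpers

/-- The hypothesis obtained from the reduced uniform interpolant is
equivalent, relative to `O`, to any semantically minimal `S_A`-hypothesis for `ψ`. -/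
theorem reduced_hypothesis_equiv_minimal
    (ι : L' →ᴸ L) (O : L.Theory) (ψ : L.Sentence)
    (V : L.Theory) (hfin : V.Finite)
    (hUI : IsUniformInterpolant ι (O ∪ {ψ.not}) V)
    (n : ℕ) (b : Fin n → L.Sentence) (hinj : Function.Injective b)
    (hSA : ∀ i : Fin n, IsSA ι (b i))
    (hsub : Set.range b ⊆ V)
    (hred : ∀ β ∈ V \ Set.range b, (O ∪ Set.range b) ⊨ᵇ β)
    (H' : L.Sentence) (hH'SA : IsSA ι H')
    (hH'exp : (O ∪ {H'}) ⊨ᵇ ψ)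
    (hH'min : ∀ H'' : L.Sentence, IsSA ι H'' → ((O ∪ {H''}) ⊨ᵇ ψ) →
      (O ∪ {H''}) ⊨ᵇ H') :
    ((O ∪ {disj fun i => (b i).not}) ⊨ᵇ H') ∧
      ((O ∪ {H'}) ⊨ᵇ disj fun i => (b i).not) ∧
      ∀ φ : L.Sentence,
        ((O ∪ {disj fun i => (b i).not}) ⊨ᵇ φ) ↔ ((O ∪ {H'}) ⊨ᵇ φ) := by
  have hbV : ∀ i, V ⊨ᵇ b i := fun i => Theory.models_sentence_of_mem (hsub ⟨i, rfl⟩)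
  have hHψ : (O ∪ {disj fun i => (b i).not}) ⊨ᵇ ψ := by
    rw [union_singleton_models_iff]
    intro M hM
    obtain ⟨i, hi⟩ := (realize_disj M _).1 hM
    by_contra hψ
    exact (Sentence.realize_not M).1 hi (union_singleton_models_iff.1
      ((hUI.2 _ (hSA i)).2 (hbV i)) M ((Sentence.realize_not M).2 hψ))
  have hHH' := hH'min _ (isSA_disj fun i => (hSA i).not) hHψ
  have hVH' : V ⊨ᵇ H'.not := by
    refine (hUI.2 _ hH'SA.not).1 (union_singleton_models_iff.2 fun M hM => ?_)
    rw [Sentence.realize_not] at hM ⊢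
    exact fun h => hM (union_singleton_models_iff.1 hH'exp M h)
  have hH'H : (O ∪ {H'}) ⊨ᵇ disj fun i => (b i).not := by
    rw [union_singleton_models_iff]
    intro M hM
    by_contra hH
    simp only [realize_disj, Sentence.realize_not, not_exists, not_not] at hH
    have hrange : M ⊨ Set.range b := by
      rw [Theory.model_iff]
      rintro _ ⟨i, rfl⟩
      exact hH i
    have hMV : M ⊨ V := by
      rw [Theory.model_iff]
      intro β hβ
      by_cases hβb : β ∈ Set.range b
      · exact hrange.realize_of_mem β hβb
      · exact union_models_iff.1 (hred β ⟨hβ, hβb⟩) M hrange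
    exact (Sentence.realize_not M).1
      (Theory.models_sentence_iff.1 hVH' (Theory.ModelType.of V M)) hM
  refine ⟨hHH', hH'H, fun φ => ?_⟩
  simp only [union_singleton_models_iff] at hHH' hH'H ⊢
  exact ⟨fun h M hM => h M (hH'H M hM), fun h M hM => h M (hHH' M hM)⟩

end Abduction
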